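/- arXiv:2405.03249 — 3 statements merged into one kernel-verified Lean document; each statement's English description precedes it below -/
import Mathlib

section
/- Let f = (f11,f12,f22) be a symmetric 2-tensor field with C² components compactly supported in the open unit disk, and assume u1 ≠ u2. Then for every x ∈ ℝ², f11(x) = -X_{e2}[ ( u2²·D_u D_v (Tf) - u1²·D_u D_v (Lf) + 4·u1²·u2·∂f12/∂x1 ) / ( 2·u2·(u1² - u2²) ) ](x). -/
open MeasureTheory

noncomputable section

/-- Rotation of a vector by 90 degrees: `w⊥ = (-w2, w1)`. -/
def perp (w : ℝ × ℝ) : ℝ × ℝ := (-w.2, w.1)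

/-- Divergent beam transform `X_w h (x) = ∫_0^∞ h(x + t w) dt`. -/
def Xray (w : ℝ × ℝ) (h : ℝ × ℝ → ℝ) (x : ℝ × ℝ) : ℝ :=
  ∫ t in Set.Ioi (0:ℝ), h (x + t • w)

/-- First moment divergent beam transform `X¹_w h (x) = ∫_0^∞ t·h(x + t w) dt`. -/
def Xray1 (w : ℝ × ℝ) (h : ℝ × ℝ → ℝ) (x : ℝ × ℝ) : ℝ :=
  ∫ t in Set.Ioi (0:ℝ), t * h (x + t • w)

/-- Directional derivative `D_w h = w1 ∂h/∂x1 + w2 ∂h/∂x2`. -/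
def Dw (w : ℝ × ℝ) (h : ℝ × ℝ → ℝ) (x : ℝ × ℝ) : ℝ :=
  fderiv ℝ h x w

/-- Partial derivative in the first coordinate. -/
def pdx (h : ℝ × ℝ → ℝ) : ℝ × ℝ → ℝ := Dw (1, 0) h

/-- Partial derivative in the second coordinate. -/
def pdy (h : ℝ × ℝ → ℝ) : ℝ × ℝ → ℝ := Dw (0, 1) h

/-- The open unit disk in ℝ². -/
def unitDisk : Set (ℝ × ℝ) := {x | x.1 ^ 2 + x.2 ^ 2 < 1}

/-- `⟨f, w²⟩ = f11 w1² + 2 f12 w1 w2 + f22 w2²`. -/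
def proj2 (f11 f12 f22 : ℝ × ℝ → ℝ) (w : ℝ × ℝ) (x : ℝ × ℝ) : ℝ :=
  f11 x * w.1 ^ 2 + 2 * f12 x * w.1 * w.2 + f22 x * w.2 ^ 2

/-- `⟨f, w ⊙ w⊥⟩ = -f11 w1 w2 + f12 (w1² - w2²) + f22 w1 w2`. -/
def projMix (f11 f12 f22 : ℝ × ℝ → ℝ) (w : ℝ × ℝ) (x : ℝ × ℝ) : ℝ :=
  -(f11 x) * w.1 * w.2 + f12 x * (w.1 ^ 2 - w.2 ^ 2) + f22 x * w.1 * w.2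

/-- V-line transform of a scalar function. -/
def Vlt (u v : ℝ × ℝ) (h : ℝ × ℝ → ℝ) (x : ℝ × ℝ) : ℝ := Xray u h x + Xray v h x

/-- Longitudinal V-line transform. -/
def Lf (u v : ℝ × ℝ) (f11 f12 f22 : ℝ × ℝ → ℝ) (x : ℝ × ℝ) : ℝ :=
  Xray u (proj2 f11 f12 f22 u) x + Xray v (proj2 f11 f12 f22 v) x

/-- Transverse V-line transform. -/
def Tf (u v : ℝ × ℝ) (f11 f12 f22 : ℝ × ℝ → ℝ) (x : ℝ × ℝ) : ℝ :=
  Xray u (proj2 f11 f12 f22 (perp u)) x + Xray v (proj2 f11 f12 f22 (perp v)) x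

/-- Mixed V-line transform. -/
def Mf (u v : ℝ × ℝ) (f11 f12 f22 : ℝ × ℝ → ℝ) (x : ℝ × ℝ) : ℝ :=
  Xray u (projMix f11 f12 f22 u) x + Xray v (projMix f11 f12 f22 v) x

/-- First moment longitudinal V-line transform. -/
def L1f (u v : ℝ × ℝ) (f11 f12 f22 : ℝ × ℝ → ℝ) (x : ℝ × ℝ) : ℝ :=
  Xray1 u (proj2 f11 f12 f22 u) x + Xray1 v (proj2 f11 f12 f22 v) x

theorem hasCompactSupport_of_tsupport_subset_unitDisk {h : ℝ × ℝ → ℝ}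
    (hs : tsupport h ⊆ unitDisk) : HasCompactSupport h := by
  refine (isCompact_closedBall (0 : ℝ × ℝ) 1).of_isClosed_subset (isClosed_tsupport h) ?_
  intro x hx
  have hx' : x.1 ^ 2 + x.2 ^ 2 < 1 := hs hx
  rw [mem_closedBall_zero_iff, Prod.norm_def, Real.norm_eq_abs, Real.norm_eq_abs]
  exact max_le (abs_le_one_iff_mul_self_le_one.2 (by nlinarith [sq_nonneg x.2]))
    (abs_le_one_iff_mul_self_le_one.2 (by nlinarith [sq_nonneg x.1]))

theorem isClosedEmbedding_line {w : ℝ × ℝ} (hw : w ≠ 0) (x : ℝ × ℝ) :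
    Topology.IsClosedEmbedding (fun t : ℝ => x + t • w) :=
  (Homeomorph.addLeft x).isClosedEmbedding.comp (isClosedEmbedding_smul_left hw)

theorem integrableOn_line {E : Type*} [NormedAddCommGroup E] {h : ℝ × ℝ → E}
    (hc : Continuous h) (hs : HasCompactSupport h) {w : ℝ × ℝ} (hw : w ≠ 0) (x : ℝ × ℝ) :
    IntegrableOn (fun t : ℝ => h (x + t • w)) (Set.Ioi 0) :=
  ((hc.comp (isClosedEmbedding_line hw x).continuous).integrable_of_hasCompactSupport
    (hs.comp_isClosedEmbedding (isClosedEmbedding_line hw x))).integrableOn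

/-- Differentiation under the integral sign for the divergent beam transform. -/
theorem hasFDerivAt_Xray {h : ℝ × ℝ → ℝ} (hh : ContDiff ℝ 1 h) (hs : HasCompactSupport h)
    {w : ℝ × ℝ} (hw : w ≠ 0) (x : ℝ × ℝ) :
    HasFDerivAt (Xray w h) (∫ t in Set.Ioi (0 : ℝ), fderiv ℝ h (x + t • w)) x := by
  have hc' : Continuous (fderiv ℝ h) := hh.continuous_fderiv one_ne_zero
  have hs' : HasCompactSupport (fderiv ℝ h) := hs.fderiv ℝ
  obtain ⟨C, hC⟩ := hc'.bounded_above_of_compact_support hs'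
  obtain ⟨r, hr⟩ := hs'.isCompact.isBounded.subset_closedBall (0 : ℝ × ℝ)
  have hw0 : 0 < ‖w‖ := norm_pos_iff.2 hw
  set R : ℝ := (r + ‖x‖ + 1) / ‖w‖ with hR
  refine hasFDerivAt_integral_of_dominated_of_fderiv_le
    (F' := fun y t => fderiv ℝ h (y + t • w)) (bound := (Set.Icc 0 R).indicator fun _ => C)
    (Metric.ball_mem_nhds x one_pos)
    (.of_forall fun y => (integrableOn_line hh.continuous hs hw y).aestronglyMeasurable)
    (integrableOn_line hh.continuous hs hw x)
    (integrableOn_line hc' hs' hw x).aestronglyMeasurable ?_ ?_ ?_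
  · filter_upwards [ae_restrict_mem measurableSet_Ioi] with t (ht : 0 < t) y hy
    by_cases htR : t ≤ R
    · rw [Set.indicator_of_mem (Set.mem_Icc.2 ⟨ht.le, htR⟩)]
      exact hC _
    · rw [Set.indicator_of_notMem fun hm => htR hm.2, norm_le_zero_iff]
      refine image_eq_zero_of_notMem_tsupport fun hmem => ?_
      have h1 : ‖y + t • w‖ ≤ r := mem_closedBall_zero_iff.1 (hr hmem)
      have h2 : ‖y‖ ≤ ‖x‖ + 1 := by
        have := norm_le_norm_add_norm_sub' y x
        have := mem_ball_iff_norm.1 hy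
        linarith
      have h3 : ‖t • w‖ ≤ ‖y + t • w‖ + ‖y‖ := by
        simpa using norm_sub_le (y + t • w) y
      rw [norm_smul, Real.norm_of_nonneg ht.le] at h3
      rw [not_le, hR, div_lt_iff₀ hw0] at htR
      linarith
  · exact ((integrable_indicator_iff measurableSet_Icc).2
      (integrableOn_const isCompact_Icc.measure_lt_top.ne)).integrableOn
  · refine .of_forall fun t y _ => ?_
    exact (hasFDerivAt_comp_add_right (t • w)).2
      (hh.differentiable one_ne_zero (y + t • w)).hasFDerivAt

theorem differentiable_Xray {h : ℝ × ℝ → ℝ} (hh : ContDiff ℝ 1 h) (hs : HasCompactSupport h)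
    {w : ℝ × ℝ} (hw : w ≠ 0) : Differentiable ℝ (Xray w h) :=
  fun x => (hasFDerivAt_Xray hh hs hw x).differentiableAt

theorem Dw_Xray {h : ℝ × ℝ → ℝ} (hh : ContDiff ℝ 1 h) (hs : HasCompactSupport h)
    {w : ℝ × ℝ} (hw : w ≠ 0) (z : ℝ × ℝ) : Dw z (Xray w h) = Xray w (Dw z h) := by
  funext x
  rw [Dw, (hasFDerivAt_Xray hh hs hw x).fderiv, ContinuousLinearMap.integral_apply
    (integrableOn_line (hh.continuous_fderiv one_ne_zero) (hs.fderiv ℝ) hw x)]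
  rfl

/-- The fundamental theorem of calculus along a ray. -/
theorem Xray_Dw_self {h : ℝ × ℝ → ℝ} (hh : ContDiff ℝ 1 h) (hs : HasCompactSupport h)
    {w : ℝ × ℝ} (hw : w ≠ 0) : Xray w (Dw w h) = -h := by
  funext x
  have hd (t : ℝ) : deriv (fun t : ℝ => h (x + t • w)) t = Dw w h (x + t • w) := by
    have hl : HasDerivAt (fun t : ℝ => x + t • w) w t := by
      simpa using ((hasDerivAt_id t).smul_const w).const_add x
    exact ((hh.differentiable one_ne_zero (x + t • w)).hasFDerivAt.comp_hasDerivAt t hl).deriv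
  have key := HasCompactSupport.integral_Ioi_deriv_eq
    (f := fun t : ℝ => h (x + t • w)) (by fun_prop)
    (hs.comp_isClosedEmbedding (isClosedEmbedding_line hw x)) 0
  simpa [hd, Xray] using key

theorem contDiff_Dw {h : ℝ × ℝ → ℝ} (hh : ContDiff ℝ 2 h) (z : ℝ × ℝ) :
    ContDiff ℝ 1 (Dw z h) :=
  (hh.fderiv_right (m := 1) (by norm_num)).clm_apply contDiff_const

theorem hasCompactSupport_Dw {h : ℝ × ℝ → ℝ} (hs : HasCompactSupport h) (z : ℝ × ℝ) :
    HasCompactSupport (Dw z h) :=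
  hs.fderiv_apply ℝ z

theorem Dw_Dw_Xray_add_Xray {h k : ℝ × ℝ → ℝ} (hh : ContDiff ℝ 2 h) (hsh : HasCompactSupport h)
    (hk : ContDiff ℝ 2 k) (hsk : HasCompactSupport k) {u v : ℝ × ℝ} (hu : u ≠ 0) (hv : v ≠ 0)
    (x : ℝ × ℝ) :
    Dw u (Dw v (fun y => Xray u h y + Xray v k y)) x = -Dw v h x - Dw u k x := by
  have hh1 := hh.of_le one_le_two
  have hk1 := hk.of_le one_le_two
  have hinner : Dw v (fun y => Xray u h y + Xray v k y) = Xray u (Dw v h) - k := by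
    have hv' : Dw v (fun y => Xray u h y + Xray v k y) = Dw v (Xray u h) + Dw v (Xray v k) := by
      funext y
      simp only [Dw, Pi.add_apply]
      rw [fderiv_fun_add (differentiable_Xray hh1 hsh hu y) (differentiable_Xray hk1 hsk hv y)]
      rfl
    rw [hv', Dw_Xray hh1 hsh hu, Dw_Xray hk1 hsk hv, Xray_Dw_self hk1 hsk hv, sub_eq_add_neg]
  have houter := congrFun (Dw_Xray (contDiff_Dw hh v) (hasCompactSupport_Dw hsh v) hu u) x
  rw [Xray_Dw_self (contDiff_Dw hh v) (hasCompactSupport_Dw hsh v) hu] at houter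
  rw [hinner, Dw, fderiv_sub (differentiable_Xray (contDiff_Dw hh v)
    (hasCompactSupport_Dw hsh v) hu x) (hk1.differentiable one_ne_zero x)]
  exact congrArg (· - Dw u k x) houter

theorem contDiff_proj2 {n : WithTop ℕ∞} {f11 f12 f22 : ℝ × ℝ → ℝ} (hf11 : ContDiff ℝ n f11)
    (hf12 : ContDiff ℝ n f12) (hf22 : ContDiff ℝ n f22) (w : ℝ × ℝ) :
    ContDiff ℝ n (proj2 f11 f12 f22 w) := by
  unfold proj2
  fun_prop

theorem hasCompactSupport_proj2 {f11 f12 f22 : ℝ × ℝ → ℝ} (hs11 : HasCompactSupport f11)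
    (hs12 : HasCompactSupport f12) (hs22 : HasCompactSupport f22) (w : ℝ × ℝ) :
    HasCompactSupport (proj2 f11 f12 f22 w) :=
  (hs11.mul_right.add (hs12.mul_left (f := fun _ => 2)).mul_right.mul_right).add hs22.mul_right

theorem Dw_proj2 {f11 f12 f22 : ℝ × ℝ → ℝ} (hf11 : Differentiable ℝ f11)
    (hf12 : Differentiable ℝ f12) (hf22 : Differentiable ℝ f22) (w z x : ℝ × ℝ) :
    Dw z (proj2 f11 f12 f22 w) x = proj2 (Dw z f11) (Dw z f12) (Dw z f22) w x := by
  have hd := ((((hf11 x).hasFDerivAt.mul_const (w.1 ^ 2)).add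
    ((((hf12 x).hasFDerivAt.const_mul 2).mul_const w.1).mul_const w.2)).add
    ((hf22 x).hasFDerivAt.mul_const (w.2 ^ 2)))
  have he : fderiv ℝ (proj2 f11 f12 f22 w) x = _ := hd.fderiv
  rw [Dw, he]
  simp [proj2, Dw]
  ring

theorem Dw_eq_pdx_add_pdy (z : ℝ × ℝ) (h : ℝ × ℝ → ℝ) (x : ℝ × ℝ) :
    Dw z h x = z.1 * pdx h x + z.2 * pdy h x := by
  have hz : z = z.1 • ((1, 0) : ℝ × ℝ) + z.2 • ((0, 1) : ℝ × ℝ) := by ext <;> simp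
  simp only [pdx, pdy, Dw]
  conv_lhs => rw [hz]
  simp only [map_add, map_smul, smul_eq_mul]

theorem stmt_12 (u1 u2 : ℝ) (hu1 : 0 < u1) (hu2 : 0 < u2) (huv : u1 ^ 2 + u2 ^ 2 = 1)
    (f11 f12 f22 : ℝ × ℝ → ℝ)
    (hf11 : ContDiff ℝ 2 f11) (hf12 : ContDiff ℝ 2 f12) (hf22 : ContDiff ℝ 2 f22)
    (hs11 : tsupport f11 ⊆ unitDisk) (hs12 : tsupport f12 ⊆ unitDisk)
    (hs22 : tsupport f22 ⊆ unitDisk)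
    (hune : u1 ≠ u2) :
    ∀ x : ℝ × ℝ,
      f11 x =
        -Xray (0, 1) (fun y =>
          (u2 ^ 2 * Dw (u1, u2) (Dw (-u1, u2) (Tf (u1, u2) (-u1, u2) f11 f12 f22)) y -
              u1 ^ 2 * Dw (u1, u2) (Dw (-u1, u2) (Lf (u1, u2) (-u1, u2) f11 f12 f22)) y +
            4 * u1 ^ 2 * u2 * pdx f12 y) / (2 * u2 * (u1 ^ 2 - u2 ^ 2))) x := by
  have hc11 := hasCompactSupport_of_tsupport_subset_unitDisk hs11
  have hc12 := hasCompactSupport_of_tsupport_subset_unitDisk hs12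
  have hc22 := hasCompactSupport_of_tsupport_subset_unitDisk hs22
  have hd11 := hf11.differentiable two_ne_zero
  have hd12 := hf12.differentiable two_ne_zero
  have hd22 := hf22.differentiable two_ne_zero
  have hu : ((u1, u2) : ℝ × ℝ) ≠ 0 := fun h => hu2.ne' (congrArg Prod.snd h)
  have hv : ((-u1, u2) : ℝ × ℝ) ≠ 0 := fun h => hu2.ne' (congrArg Prod.snd h)
  have he2 : ((0, 1) : ℝ × ℝ) ≠ 0 := fun h => one_ne_zero (congrArg Prod.snd h)
  have hsub : u1 ^ 2 - u2 ^ 2 ≠ 0 := by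
    rw [sq_sub_sq]
    exact mul_ne_zero (by positivity) (sub_ne_zero.2 hune)
  have hproj (w w' : ℝ × ℝ) (y : ℝ × ℝ) :=
    Dw_Dw_Xray_add_Xray (contDiff_proj2 hf11 hf12 hf22 w) (hasCompactSupport_proj2 hc11 hc12 hc22 w)
      (contDiff_proj2 hf11 hf12 hf22 w') (hasCompactSupport_proj2 hc11 hc12 hc22 w') hu hv y
  have hL (y : ℝ × ℝ) := hproj (u1, u2) (-u1, u2) y
  have hT (y : ℝ × ℝ) := hproj (perp (u1, u2)) (perp (-u1, u2)) y
  intro x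
  have hintegrand : (fun y =>
      (u2 ^ 2 * Dw (u1, u2) (Dw (-u1, u2) (Tf (u1, u2) (-u1, u2) f11 f12 f22)) y -
          u1 ^ 2 * Dw (u1, u2) (Dw (-u1, u2) (Lf (u1, u2) (-u1, u2) f11 f12 f22)) y +
        4 * u1 ^ 2 * u2 * pdx f12 y) / (2 * u2 * (u1 ^ 2 - u2 ^ 2))) = Dw (0, 1) f11 := by
    funext y
    rw [div_eq_iff (by positivity)]
    unfold Tf Lf
    rw [hT, hL]
    simp only [Dw_proj2 hd11 hd12 hd22, proj2, perp, Dw_eq_pdx_add_pdy]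
    linear_combination (2 * u2 * (u1 ^ 2 - u2 ^ 2) * pdy f11 y - 4 * u1 ^ 2 * u2 * pdx f12 y) * huv
  rw [hintegrand, Xray_Dw_self (hf11.of_le one_le_two) hc11 he2]
  simp
end
end

section
/- Let f = (f11,f12,f22) be a symmetric 2-tensor field with C² components compactly supported in the open unit disk. Then for every x ∈ ℝ², f22(x) = (1/(2·u2))·D_u D_v X_{e2}(Lf + Tf)(x) - f11(x). -/
open MeasureTheory

noncomputable section

/-- The function `h` vanishes on the open half-plane `x2 > 1`. -/
def VanishesAbove (h : ℝ × ℝ → ℝ) : Prop := ∀ x : ℝ × ℝ, 1 < x.2 → h x = 0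

lemma lt_snd_add_smul {w x : ℝ × ℝ} {s t : ℝ} (hw : 0 < w.2) (hst : s ≤ t)
    (hx : 1 < x.2 + s * w.2) : 1 < (x + t • w).2 := by
  have := mul_le_mul_of_nonneg_right hst hw.le
  simp only [Prod.snd_add, Prod.smul_snd, smul_eq_mul]
  linarith

lemma VanishesAbove.xray_eq_intervalIntegral {h : ℝ × ℝ → ℝ} (hv : VanishesAbove h)
    {w x : ℝ × ℝ} {T : ℝ} (hw : 0 < w.2) (hT : 0 ≤ T) (hx : 1 < x.2 + T * w.2) :
    Xray w h x = ∫ t in (0 : ℝ)..T, h (x + t • w) := by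
  rw [intervalIntegral.integral_of_le hT]
  refine setIntegral_eq_of_subset_of_forall_sdiff_eq_zero measurableSet_Ioi
    Set.Ioc_subset_Ioi_self fun t ht ↦ hv _ (lt_snd_add_smul hw ?_ hx)
  by_contra! hlt
  exact ht.2 ⟨ht.1, hlt.le⟩

lemma exists_eventually_lt_snd_add {w : ℝ × ℝ} (hw : 0 < w.2) (x : ℝ × ℝ) :
    ∃ T : ℝ, 0 ≤ T ∧ ∀ᶠ y : ℝ × ℝ in nhds x, 1 < y.2 + T * w.2 := by
  refine ⟨(|x.2| + 2) / w.2, by positivity, ?_⟩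
  have hx : 1 < x.2 + (|x.2| + 2) / w.2 * w.2 := by
    rw [div_mul_cancel₀ _ hw.ne']
    linarith [neg_abs_le x.2]
  exact (continuous_snd.add continuous_const).continuousAt.eventually (lt_mem_nhds hx)

lemma VanishesAbove.fderiv_eq_zero {h : ℝ × ℝ → ℝ} (hv : VanishesAbove h) {x : ℝ × ℝ}
    (hx : 1 < x.2) : fderiv ℝ h x = 0 := by
  have : h =ᶠ[nhds x] fun _ ↦ 0 :=
    (continuous_snd.continuousAt.eventually (lt_mem_nhds hx)).mono fun y hy ↦ hv y hy
  rw [this.fderiv_eq]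
  simp

lemma VanishesAbove.dw {h : ℝ × ℝ → ℝ} (hv : VanishesAbove h) (w : ℝ × ℝ) :
    VanishesAbove (Dw w h) := fun x hx ↦ by simp [Dw, hv.fderiv_eq_zero hx]

lemma VanishesAbove.xray {h : ℝ × ℝ → ℝ} (hv : VanishesAbove h) {w : ℝ × ℝ} (hw : 0 < w.2) :
    VanishesAbove (Xray w h) := fun x hx ↦ by
  simp [hv.xray_eq_intervalIntegral hw le_rfl (x := x) (by simpa using hx)]

lemma VanishesAbove.add {g h : ℝ × ℝ → ℝ} (hg : VanishesAbove g) (hh : VanishesAbove h) :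
    VanishesAbove (g + h) := fun x hx ↦ by simp [hg x hx, hh x hx]

lemma hasFDerivAt_intervalIntegral_ray {h : ℝ × ℝ → ℝ} (hc : ContDiff ℝ 1 h) (w x : ℝ × ℝ)
    (T : ℝ) :
    HasFDerivAt (fun y ↦ ∫ t in (0 : ℝ)..T, h (y + t • w))
      (∫ t in (0 : ℝ)..T, fderiv ℝ h (x + t • w)) x := by
  have hc' : Continuous (fderiv ℝ h) := hc.continuous_fderiv one_ne_zero
  have hcont : Continuous fun p : (ℝ × ℝ) × ℝ ↦ fderiv ℝ h (p.1 + p.2 • w) := by fun_prop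
  obtain ⟨C, hC⟩ := ((isCompact_closedBall x 1).prod
    (isCompact_uIcc (a := (0 : ℝ)) (b := T))).exists_bound_of_continuousOn hcont.continuousOn
  refine intervalIntegral.hasFDerivAt_integral_of_dominated_of_fderiv_le (bound := fun _ ↦ C)
    (F' := fun y t ↦ fderiv ℝ h (y + t • w))
    (Metric.closedBall_mem_nhds x one_pos) (.of_forall fun y ↦ ?_) ?_ ?_
    (.of_forall fun t ht y hy ↦ hC (y, t) ⟨hy, Set.uIoc_subset_uIcc ht⟩) (by simp)
    (.of_forall fun t _ y _ ↦ ?_)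
  · have := hc.continuous
    exact (by fun_prop : Continuous fun t : ℝ ↦ h (y + t • w)).aestronglyMeasurable
  · have := hc.continuous
    exact (by fun_prop : Continuous fun t : ℝ ↦ h (x + t • w)).intervalIntegrable _ _
  · exact (by fun_prop : Continuous fun t : ℝ ↦ fderiv ℝ h (x + t • w)).aestronglyMeasurable
  · exact (hasFDerivAt_comp_add_right (t • w)).2
      (hc.differentiable one_ne_zero (y + t • w)).hasFDerivAt

lemma VanishesAbove.hasFDerivAt_xray {h : ℝ × ℝ → ℝ} (hv : VanishesAbove h)
    (hc : ContDiff ℝ 1 h) {w x : ℝ × ℝ} {T : ℝ} (hw : 0 < w.2) (hT : 0 ≤ T)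
    (hx : 1 < x.2 + T * w.2) :
    HasFDerivAt (Xray w h) (∫ t in (0 : ℝ)..T, fderiv ℝ h (x + t • w)) x := by
  refine (hasFDerivAt_intervalIntegral_ray hc w x T).congr_of_eventuallyEq ?_
  filter_upwards [(continuous_snd.add continuous_const).continuousAt.eventually
    (lt_mem_nhds hx)] with y hy using hv.xray_eq_intervalIntegral hw hT hy

lemma VanishesAbove.contDiff_xray {h : ℝ × ℝ → ℝ} (hv : VanishesAbove h)
    (hc : ContDiff ℝ 1 h) {w : ℝ × ℝ} (hw : 0 < w.2) : ContDiff ℝ 1 (Xray w h) := by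
  have hc' : Continuous (fderiv ℝ h) := hc.continuous_fderiv one_ne_zero
  refine contDiff_one_iff_fderiv.2 ⟨fun x ↦ ?_, continuous_iff_continuousAt.2 fun x ↦ ?_⟩
  · obtain ⟨T, hT, hx⟩ := exists_eventually_lt_snd_add hw x
    exact (hv.hasFDerivAt_xray hc hw hT hx.self_of_nhds).differentiableAt
  · obtain ⟨T, hT, hx⟩ := exists_eventually_lt_snd_add hw x
    have hcont : Continuous fun y ↦ ∫ t in (0 : ℝ)..T, fderiv ℝ h (y + t • w) :=
      intervalIntegral.continuous_parametric_intervalIntegral_of_continuous' (by fun_prop) _ _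
    exact hcont.continuousAt.congr
      (hx.mono fun y hy ↦ (hv.hasFDerivAt_xray hc hw hT hy).fderiv.symm)

lemma VanishesAbove.dw_xray_comm {h : ℝ × ℝ → ℝ} (hv : VanishesAbove h)
    (hc : ContDiff ℝ 1 h) {w : ℝ × ℝ} (hw : 0 < w.2) (z : ℝ × ℝ) :
    Dw z (Xray w h) = Xray w (Dw z h) := by
  ext x
  obtain ⟨T, hT, hx⟩ := exists_eventually_lt_snd_add hw x
  have hc' : Continuous (fderiv ℝ h) := hc.continuous_fderiv one_ne_zero
  rw [Dw, (hv.hasFDerivAt_xray hc hw hT hx.self_of_nhds).fderiv,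
    (hv.dw z).xray_eq_intervalIntegral hw hT hx.self_of_nhds,
    ContinuousLinearMap.intervalIntegral_apply
      ((by fun_prop : Continuous fun t : ℝ ↦ fderiv ℝ h (x + t • w)).intervalIntegrable _ _)]
  rfl

lemma VanishesAbove.xray_dw_self {h : ℝ × ℝ → ℝ} (hv : VanishesAbove h)
    (hc : ContDiff ℝ 1 h) {w : ℝ × ℝ} (hw : 0 < w.2) : Xray w (Dw w h) = -h := by
  ext x
  obtain ⟨T, hT, hx⟩ := exists_eventually_lt_snd_add hw x
  have hc' : Continuous (fderiv ℝ h) := hc.continuous_fderiv one_ne_zero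
  rw [(hv.dw w).xray_eq_intervalIntegral hw hT hx.self_of_nhds,
    intervalIntegral.integral_eq_sub_of_hasDerivAt (f := fun t : ℝ ↦ h (x + t • w))]
  · simp [hv _ (lt_snd_add_smul hw le_rfl hx.self_of_nhds)]
  · intro t _
    have hline : HasDerivAt (fun t : ℝ ↦ x + t • w) w t := by
      simpa using ((hasDerivAt_id t).smul_const w).const_add x
    exact ((hc.differentiable one_ne_zero (x + t • w)).hasFDerivAt).comp_hasDerivAt t hline
  · exact (by unfold Dw; fun_prop :
      Continuous fun t : ℝ ↦ Dw w h (x + t • w)).intervalIntegrable _ _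

lemma VanishesAbove.xray_add {g h : ℝ × ℝ → ℝ} (hg : VanishesAbove g) (hh : VanishesAbove h)
    (hgc : Continuous g) (hhc : Continuous h) {w : ℝ × ℝ} (hw : 0 < w.2) :
    Xray w (g + h) = Xray w g + Xray w h := by
  ext x
  obtain ⟨T, hT, hx⟩ := exists_eventually_lt_snd_add hw x
  have hx := hx.self_of_nhds
  rw [Pi.add_apply, (hg.add hh).xray_eq_intervalIntegral hw hT hx,
    hg.xray_eq_intervalIntegral hw hT hx, hh.xray_eq_intervalIntegral hw hT hx]
  exact intervalIntegral.integral_add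
    ((by fun_prop : Continuous fun t : ℝ ↦ g (x + t • w)).intervalIntegrable _ _)
    ((by fun_prop : Continuous fun t : ℝ ↦ h (x + t • w)).intervalIntegrable _ _)

lemma Dw_add {g h : ℝ × ℝ → ℝ} (hg : Differentiable ℝ g) (hh : Differentiable ℝ h)
    (w : ℝ × ℝ) : Dw w (g + h) = Dw w g + Dw w h := by
  ext x
  simp [Dw, fderiv_add (hg x) (hh x)]

lemma Dw_neg (h : ℝ × ℝ → ℝ) (w : ℝ × ℝ) : Dw w (-h) = -Dw w h := by
  ext x
  simp [Dw, fderiv_neg]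

lemma contDiff_Dw_s13 {h : ℝ × ℝ → ℝ} (hc : ContDiff ℝ 2 h) (w : ℝ × ℝ) :
    ContDiff ℝ 1 (Dw w h) :=
  (hc.fderiv_right (m := 1) (by norm_num)).clm_apply contDiff_const

lemma proj2_add_proj2_perp (f11 f12 f22 : ℝ × ℝ → ℝ) {w : ℝ × ℝ}
    (hw : w.1 ^ 2 + w.2 ^ 2 = 1) :
    proj2 f11 f12 f22 w + proj2 f11 f12 f22 (perp w) = f11 + f22 := by
  ext x
  simp only [proj2, perp, Pi.add_apply]
  linear_combination (f11 x + f22 x) * hw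

lemma continuous_proj2 {f11 f12 f22 : ℝ × ℝ → ℝ} (h11 : Continuous f11) (h12 : Continuous f12)
    (h22 : Continuous f22) (w : ℝ × ℝ) : Continuous (proj2 f11 f12 f22 w) := by
  unfold proj2
  fun_prop

lemma VanishesAbove.proj2 {f11 f12 f22 : ℝ × ℝ → ℝ} (h11 : VanishesAbove f11)
    (h12 : VanishesAbove f12) (h22 : VanishesAbove f22) (w : ℝ × ℝ) :
    VanishesAbove (proj2 f11 f12 f22 w) := fun x hx ↦ by
  simp [_root_.proj2, h11 x hx, h12 x hx, h22 x hx]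

lemma vanishesAbove_of_tsupport_subset {h : ℝ × ℝ → ℝ} (hs : tsupport h ⊆ unitDisk) :
    VanishesAbove h := fun x hx ↦ by
  by_contra hne
  have : x.1 ^ 2 + x.2 ^ 2 < 1 := hs (subset_tsupport h hne)
  nlinarith [sq_nonneg x.1]

lemma Lf_add_Tf_eq_Vlt {f11 f12 f22 : ℝ × ℝ → ℝ} (c11 : Continuous f11) (c12 : Continuous f12)
    (c22 : Continuous f22) (h11 : VanishesAbove f11) (h12 : VanishesAbove f12)
    (h22 : VanishesAbove f22) {u v : ℝ × ℝ} (hu : u.1 ^ 2 + u.2 ^ 2 = 1)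
    (hv : v.1 ^ 2 + v.2 ^ 2 = 1) (hu2 : 0 < u.2) (hv2 : 0 < v.2) :
    (fun y ↦ Lf u v f11 f12 f22 y + Tf u v f11 f12 f22 y) = Vlt u v (f11 + f22) := by
  have key {w : ℝ × ℝ} (hw : w.1 ^ 2 + w.2 ^ 2 = 1) (hw2 : 0 < w.2) (x : ℝ × ℝ) :
      Xray w (f11 + f22) x =
        Xray w (proj2 f11 f12 f22 w) x + Xray w (proj2 f11 f12 f22 (perp w)) x := by
    rw [← proj2_add_proj2_perp f11 f12 f22 hw, (h11.proj2 h12 h22 w).xray_add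
      (h11.proj2 h12 h22 (perp w)) (continuous_proj2 c11 c12 c22 _)
      (continuous_proj2 c11 c12 c22 _) hw2]
    rfl
  ext x
  rw [Vlt, key hu hu2, key hv hv2, Lf, Tf]
  ring

/-- Inversion of the composition of a beam transform and a V-line transform by two directional
derivatives. -/
lemma VanishesAbove.dw_dw_xray_vlt {g : ℝ × ℝ → ℝ} (hg : VanishesAbove g)
    (hc : ContDiff ℝ 2 g) {u v w : ℝ × ℝ} (hu : 0 < u.2) (hv : 0 < v.2) (hw : 0 < w.2) {c : ℝ}
    (huv : u + v = c • w) (x : ℝ × ℝ) :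
    Dw u (Dw v (Xray w (Vlt u v g))) x = c * g x := by
  have hc1 : ContDiff ℝ 1 g := hc.of_le (by norm_num)
  have hVlt : Vlt u v g = Xray u g + Xray v g := rfl
  have cu := hg.contDiff_xray hc1 hu
  have cv := hg.contDiff_xray hc1 hv
  have hd := contDiff_Dw_s13 hc v
  have cn : ContDiff ℝ 1 (-g) := hc1.neg
  have cud := (hg.dw v).contDiff_xray hd hu
  have hneg : VanishesAbove (-g) := fun y hy ↦ by simp [hg y hy]
  have hS : VanishesAbove (Xray u (Dw v g) + -g) := ((hg.dw v).xray hu).add hneg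
  have hD : Dw u (Xray u (Dw v g) + -g) = Dw (c • w) (-g) := by
    rw [Dw_add (cud.differentiable one_ne_zero) (cn.differentiable one_ne_zero),
      (hg.dw v).dw_xray_comm hd hu, (hg.dw v).xray_dw_self hd hu, Dw_neg, Dw_neg, ← huv]
    ext y
    simp only [Dw, Pi.add_apply, Pi.neg_apply, map_add]
    ring
  have hsmul : Dw (c • w) (-g) = Dw w (-(c • g)) := by
    ext y
    rw [Dw_neg, Dw_neg]
    simp [Dw, fderiv_const_smul (hc1.differentiable one_ne_zero y)]
  have hcg : VanishesAbove (-(c • g)) := fun y hy ↦ by simp [hg y hy]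
  rw [hVlt, ((hg.xray hu).add (hg.xray hv)).dw_xray_comm (cu.add cv) hw,
    Dw_add (cu.differentiable one_ne_zero) (cv.differentiable one_ne_zero),
    hg.dw_xray_comm hc1 hu, hg.dw_xray_comm hc1 hv, hg.xray_dw_self hc1 hv,
    hS.dw_xray_comm (cud.add cn) hw, hD, hsmul,
    hcg.xray_dw_self (hc1.const_smul c).neg hw]
  simp

theorem stmt_13 (u1 u2 : ℝ) (hu1 : 0 < u1) (hu2 : 0 < u2) (huv : u1 ^ 2 + u2 ^ 2 = 1)
    (f11 f12 f22 : ℝ × ℝ → ℝ)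
    (hf11 : ContDiff ℝ 2 f11) (hf12 : ContDiff ℝ 2 f12) (hf22 : ContDiff ℝ 2 f22)
    (hs11 : tsupport f11 ⊆ unitDisk) (hs12 : tsupport f12 ⊆ unitDisk)
    (hs22 : tsupport f22 ⊆ unitDisk) :
    ∀ x : ℝ × ℝ,
      f22 x =
        (1 / (2 * u2)) *
            Dw (u1, u2) (Dw (-u1, u2) (Xray (0, 1) (fun y => Lf (u1, u2) (-u1, u2) f11 f12 f22 y + Tf (u1, u2) (-u1, u2) f11 f12 f22 y))) x -
          f11 x := by
  intro x
  have h11 := vanishesAbove_of_tsupport_subset hs11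
  have h22 := vanishesAbove_of_tsupport_subset hs22
  rw [Lf_add_Tf_eq_Vlt hf11.continuous hf12.continuous hf22.continuous h11
      (vanishesAbove_of_tsupport_subset hs12) h22 huv (by simpa using huv) hu2 hu2,
    (h11.add h22).dw_dw_xray_vlt (hf11.add hf22) hu2 hu2 one_pos (c := 2 * u2)
      (by ext <;> simp [two_mul]), Pi.add_apply]
  field_simp
  ring
end
end

section
/- Let f = (f11,f12,f22) be a symmetric 2-tensor field with C² components compactly supported in the open unit disk, let γ1,…,γm be distinct unit vectors in ℝ² and c1,…,cm nonzero reals, and let Sf be the associated star transform. Let ξ be a unit vector such that ξ·γᵢ ≠ 0 for all i, γ†(ξ) ≠ 0, and Σᵢ cᵢ/(ξ·γᵢ) ≠ 0. Then the 3×3 matrix Q(ξ) is invertible, and for every s ∈ ℝ, Q(ξ)⁻¹ · (∂/∂s)(R(Sf))(ξ,s) = (R f11(ξ,s), R f12(ξ,s), R f22(ξ,s)), where R(Sf)(ξ,s) denotes the componentwise Radon transform of the ℝ³-valued function Sf. -/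
open MeasureTheory

noncomputable section

/-- Radon transform `Rh(ξ, s) = ∫ h(s ξ + t ξ⊥) dt`. -/
def Radon (h : ℝ × ℝ → ℝ) (ξ : ℝ × ℝ) (s : ℝ) : ℝ :=
  ∫ t : ℝ, h (s • ξ + t • perp ξ)

/-- The vector `γ²  = (γ1², γ1 γ2, γ2²) ∈ ℝ³`. -/
def sq3 (γ : ℝ × ℝ) : Fin 3 → ℝ := ![γ.1 ^ 2, γ.1 * γ.2, γ.2 ^ 2]

/-- The vector `γ ⊙ γ⊥ ∈ ℝ³`. -/
def mix3 (γ : ℝ × ℝ) : Fin 3 → ℝ :=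
  ![γ.1 * (perp γ).1, (γ.1 * (perp γ).2 + γ.2 * (perp γ).1) / 2, γ.2 * (perp γ).2]

/-- Dot product in ℝ³. -/
def dot3 (a b : Fin 3 → ℝ) : ℝ := a 0 * b 0 + a 1 * b 1 + a 2 * b 2

/-- Dot product in ℝ². -/
def dot2 (a b : ℝ × ℝ) : ℝ := a.1 * b.1 + a.2 * b.2

/-- The tensor field as an ℝ³-valued function. -/
def tensorFn (f11 f12 f22 : ℝ × ℝ → ℝ) (x : ℝ × ℝ) : Fin 3 → ℝ := ![f11 x, f12 x, f22 x]

/-- The star transform of a symmetric 2-tensor field, as an ℝ³-valued function. -/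
def starT {m : ℕ} (γ : Fin m → ℝ × ℝ) (c : Fin m → ℝ)
    (f11 f12 f22 : ℝ × ℝ → ℝ) (x : ℝ × ℝ) : Fin 3 → ℝ :=
  ∑ i, c i •
    ![Xray (γ i) (fun y => dot3 (tensorFn f11 f12 f22 y) (sq3 (γ i))) x,
      Xray (γ i) (fun y => dot3 (tensorFn f11 f12 f22 y) (mix3 (γ i))) x,
      Xray (γ i) (fun y => dot3 (tensorFn f11 f12 f22 y) (sq3 (perp (γ i)))) x]

/-- `γ(ξ) = -∑ cᵢ γᵢ² / (ξ·γᵢ)`. -/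
def gammaVec {m : ℕ} (γ : Fin m → ℝ × ℝ) (c : Fin m → ℝ) (ξ : ℝ × ℝ) : Fin 3 → ℝ :=
  -∑ i, (c i / dot2 ξ (γ i)) • sq3 (γ i)

/-- `γ†(ξ) = -∑ cᵢ (γᵢ ⊙ γᵢ⊥) / (ξ·γᵢ)`. -/
def gammaDag {m : ℕ} (γ : Fin m → ℝ × ℝ) (c : Fin m → ℝ) (ξ : ℝ × ℝ) : Fin 3 → ℝ :=
  -∑ i, (c i / dot2 ξ (γ i)) • mix3 (γ i)

/-- `γ⊥(ξ) = -∑ cᵢ (γᵢ⊥)² / (ξ·γᵢ)`. -/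
def gammaPerpVec {m : ℕ} (γ : Fin m → ℝ × ℝ) (c : Fin m → ℝ) (ξ : ℝ × ℝ) : Fin 3 → ℝ :=
  -∑ i, (c i / dot2 ξ (γ i)) • sq3 (perp (γ i))

/-- The matrix `Q(ξ)` with rows `γ(ξ)`, `γ†(ξ)`, `γ⊥(ξ)`. -/
def Qmat {m : ℕ} (γ : Fin m → ℝ × ℝ) (c : Fin m → ℝ) (ξ : ℝ × ℝ) :
    Matrix (Fin 3) (Fin 3) ℝ :=
  Matrix.of ![gammaVec γ c ξ, gammaDag γ c ξ, gammaPerpVec γ c ξ]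

open Set

/-- The affine coordinates `(x, y) ↦ b + x u + y v` of the plane attached to a basis `u, v`. -/
def planeCoords (b u v : ℝ × ℝ) (huv : u.1 * v.2 - u.2 * v.1 ≠ 0) : ℝ × ℝ ≃ₜ ℝ × ℝ where
  toFun p := b + p.1 • u + p.2 • v
  invFun x :=
    (((x.1 - b.1) * v.2 - (x.2 - b.2) * v.1) / (u.1 * v.2 - u.2 * v.1),
      (u.1 * (x.2 - b.2) - u.2 * (x.1 - b.1)) / (u.1 * v.2 - u.2 * v.1))
  left_inv p := by
    ext <;> simp only [Prod.fst_add, Prod.snd_add, Prod.smul_fst, Prod.smul_snd, smul_eq_mul] <;>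
      rw [div_eq_iff huv] <;> ring
  right_inv x := by
    ext <;> simp only [Prod.fst_add, Prod.snd_add, Prod.smul_fst, Prod.smul_snd, smul_eq_mul] <;>
      rw [div_mul_eq_mul_div, div_mul_eq_mul_div, add_assoc, ← add_div, ← eq_sub_iff_add_eq',
        div_eq_iff huv] <;> ring
  continuous_toFun := by fun_prop
  continuous_invFun := by fun_prop

theorem HasCompactSupport.comp_planeCoords {h : ℝ × ℝ → ℝ} (hs : HasCompactSupport h)
    (b u v : ℝ × ℝ) (huv : u.1 * v.2 - u.2 * v.1 ≠ 0) :
    HasCompactSupport (fun p : ℝ × ℝ => h (b + p.1 • u + p.2 • v)) :=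
  hs.comp_homeomorph (planeCoords b u v huv)

theorem eq_zero_of_snd_notMem_image_tsupport {F : ℝ × ℝ → ℝ} (y t : ℝ)
    (ht : t ∉ Prod.snd '' tsupport F) : F (y, t) = 0 :=
  image_eq_zero_of_notMem_tsupport fun hm => ht ⟨(y, t), hm, rfl⟩

theorem continuous_integral_snd {F : ℝ × ℝ → ℝ} (hF : Continuous F) (hs : HasCompactSupport F) :
    Continuous (fun y => ∫ t : ℝ, F (y, t)) := by
  rw [← continuousOn_univ]
  exact continuousOn_integral_of_compact_support (f := fun y t => F (y, t))
    (hs.isCompact.image continuous_snd) hF.continuousOn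
    fun y t _ ht => eq_zero_of_snd_notMem_image_tsupport y t ht

theorem integrable_snd {F : ℝ × ℝ → ℝ} (hF : Continuous F) (hs : HasCompactSupport F) (y : ℝ) :
    Integrable (fun t : ℝ => F (y, t)) :=
  Continuous.integrable_of_hasCompactSupport (by fun_prop)
    (HasCompactSupport.intro (hs.isCompact.image continuous_snd)
      fun t ht => eq_zero_of_snd_notMem_image_tsupport y t ht)

theorem det_perp {ξ : ℝ × ℝ} (hξ : ξ.1 ^ 2 + ξ.2 ^ 2 = 1) :
    ξ.1 * (perp ξ).2 - ξ.2 * (perp ξ).1 = 1 := by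
  simp only [perp]; linarith

section Radon

variable {h : ℝ × ℝ → ℝ} {ξ : ℝ × ℝ}

theorem hasCompactSupport_radonKernel (hs : HasCompactSupport h) (hξ : ξ.1 ^ 2 + ξ.2 ^ 2 = 1) :
    HasCompactSupport (fun p : ℝ × ℝ => h (p.1 • ξ + p.2 • perp ξ)) := by
  simpa using hs.comp_planeCoords 0 ξ (perp ξ) (by simp [det_perp hξ])

theorem continuous_Radon (hh : Continuous h) (hs : HasCompactSupport h)
    (hξ : ξ.1 ^ 2 + ξ.2 ^ 2 = 1) : Continuous (Radon h ξ) :=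
  continuous_integral_snd (F := fun p : ℝ × ℝ => h (p.1 • ξ + p.2 • perp ξ)) (by fun_prop)
    (hasCompactSupport_radonKernel hs hξ)

theorem integrable_Radon (hh : Continuous h) (hs : HasCompactSupport h)
    (hξ : ξ.1 ^ 2 + ξ.2 ^ 2 = 1) : Integrable (Radon h ξ) :=
  (Continuous.integrable_of_hasCompactSupport (μ := (volume : Measure ℝ).prod volume)
    (f := fun p : ℝ × ℝ => h (p.1 • ξ + p.2 • perp ξ)) (by fun_prop)
    (hasCompactSupport_radonKernel hs hξ)).integral_prod_left

theorem integrable_line (hh : Continuous h) (hs : HasCompactSupport h)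
    (hξ : ξ.1 ^ 2 + ξ.2 ^ 2 = 1) (s : ℝ) :
    Integrable (fun t : ℝ => h (s • ξ + t • perp ξ)) :=
  integrable_snd (F := fun p : ℝ × ℝ => h (p.1 • ξ + p.2 • perp ξ)) (by fun_prop)
    (hasCompactSupport_radonKernel hs hξ) s

variable {γ : ℝ × ℝ}

theorem integrable_beamKernel (hh : Continuous h) (hs : HasCompactSupport h)
    (hγ : dot2 ξ γ ≠ 0) (s : ℝ) :
    Integrable (fun p : ℝ × ℝ => h (s • ξ + p.1 • perp ξ + p.2 • γ))
      ((volume : Measure ℝ).prod (volume.restrict (Ioi 0))) := by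
  have hdet : (perp ξ).1 * γ.2 - (perp ξ).2 * γ.1 ≠ 0 := by
    intro h0
    apply hγ
    simp only [perp] at h0
    simp only [dot2]
    linarith
  have hint : Integrable (fun p : ℝ × ℝ => h (s • ξ + p.1 • perp ξ + p.2 • γ))
      ((volume : Measure ℝ).prod volume) :=
    Continuous.integrable_of_hasCompactSupport (by fun_prop)
      (hs.comp_planeCoords (s • ξ) (perp ξ) γ hdet)
  have hres := hint.integrableOn (s := univ ×ˢ Ioi (0 : ℝ))
  rwa [IntegrableOn, ← Measure.prod_restrict, Measure.restrict_univ] at hres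

theorem integrable_Xray_line (hh : Continuous h) (hs : HasCompactSupport h)
    (hγ : dot2 ξ γ ≠ 0) (s : ℝ) :
    Integrable (fun t : ℝ => Xray γ h (s • ξ + t • perp ξ)) :=
  (integrable_beamKernel hh hs hγ s).integral_prod_left

theorem Radon_Xray (hh : Continuous h) (hs : HasCompactSupport h)
    (hξ : ξ.1 ^ 2 + ξ.2 ^ 2 = 1) (hγ : dot2 ξ γ ≠ 0) (s : ℝ) :
    Radon (Xray γ h) ξ s = ∫ r in Ioi (0 : ℝ), Radon h ξ (s + r * dot2 ξ γ) := by
  unfold Radon Xray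
  rw [integral_integral_swap (f := fun t r => h (s • ξ + t • perp ξ + r • γ))
    (integrable_beamKernel hh hs hγ s)]
  congr 1
  ext r
  rw [← integral_add_right_eq_self (μ := volume)
    (fun t : ℝ => h ((s + r * dot2 ξ γ) • ξ + t • perp ξ)) (r * dot2 (perp ξ) γ)]
  congr 1
  ext t
  congr 1
  ext
  · simp [perp, dot2]
    linear_combination (-r * γ.1) * hξ
  · simp [perp, dot2]
    linear_combination (-r * γ.2) * hξ

theorem hasDerivAt_integral_Ioi {g : ℝ → ℝ} (hg : Continuous g) (hi : Integrable g) (a : ℝ) :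
    HasDerivAt (fun x => ∫ r in Ioi x, g r) (-g a) a := by
  have heq : (fun x => ∫ r in Ioi x, g r) = fun x => (∫ r in Ioi 0, g r) - ∫ r in (0)..x, g r := by
    ext x
    rw [← intervalIntegral.integral_interval_add_Ioi (a := 0) (b := x) hi.integrableOn
      hi.integrableOn]
    ring
  rw [heq]
  exact (hg.integral_hasStrictDerivAt 0 a).hasDerivAt.const_sub _

theorem integral_Ioi_zero_comp_add (g : ℝ → ℝ) (a : ℝ) :
    ∫ r in Ioi (0 : ℝ), g (a + r) = ∫ r in Ioi a, g r := by
  rw [← integral_indicator measurableSet_Ioi, ← integral_indicator measurableSet_Ioi,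
    ← integral_add_left_eq_self (μ := volume) ((Ioi a).indicator g) a]
  congr 1
  ext r
  simp [indicator]

theorem hasDerivAt_integral_ray {g : ℝ → ℝ} (hg : Continuous g) (hi : Integrable g) {p : ℝ}
    (hp : p ≠ 0) (s : ℝ) :
    HasDerivAt (fun s => ∫ r in Ioi (0 : ℝ), g (s + r * p)) (-g s / p) s := by
  have heq : (fun s => ∫ r in Ioi (0 : ℝ), g (s + r * p)) =
      fun s => ∫ r in Ioi (s / p), g (r * p) := by
    ext s
    rw [← integral_Ioi_zero_comp_add (fun r => g (r * p))]
    congr 1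
    ext r
    congr 1
    field_simp
  rw [heq]
  have hd := (hasDerivAt_integral_Ioi (g := fun r => g (r * p)) (by fun_prop)
    (hi.comp_mul_right' hp) (s / p)).comp s ((hasDerivAt_id s).div_const p)
  refine hd.congr_deriv ?_
  rw [div_mul_cancel₀ s hp]
  ring

theorem hasDerivAt_Radon_Xray (hh : Continuous h) (hs : HasCompactSupport h)
    (hξ : ξ.1 ^ 2 + ξ.2 ^ 2 = 1) (hγ : dot2 ξ γ ≠ 0) (s : ℝ) :
    HasDerivAt (Radon (Xray γ h) ξ) (-Radon h ξ s / dot2 ξ γ) s := by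
  rw [show Radon (Xray γ h) ξ = _ from funext fun s => Radon_Xray hh hs hξ hγ s]
  exact hasDerivAt_integral_ray (continuous_Radon hh hs hξ) (integrable_Radon hh hs hξ) hγ s

end Radon

section Star

variable {f11 f12 f22 : ℝ × ℝ → ℝ} {ξ : ℝ × ℝ}

theorem continuous_dot3_tensorFn (h11 : Continuous f11) (h12 : Continuous f12)
    (h22 : Continuous f22) (v : Fin 3 → ℝ) :
    Continuous (fun y => dot3 (tensorFn f11 f12 f22 y) v) := by
  simp only [dot3, tensorFn, Matrix.cons_val]
  fun_prop

theorem hasCompactSupport_dot3_tensorFn (h11 : HasCompactSupport f11)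
    (h12 : HasCompactSupport f12) (h22 : HasCompactSupport f22) (v : Fin 3 → ℝ) :
    HasCompactSupport (fun y => dot3 (tensorFn f11 f12 f22 y) v) :=
  ((h11.mul_right (f' := fun _ => v 0)).add (h12.mul_right (f' := fun _ => v 1))).add
    (h22.mul_right (f' := fun _ => v 2))

theorem Radon_dot3_tensorFn (h11 : Continuous f11) (h12 : Continuous f12) (h22 : Continuous f22)
    (hs11 : HasCompactSupport f11) (hs12 : HasCompactSupport f12) (hs22 : HasCompactSupport f22)
    (hξ : ξ.1 ^ 2 + ξ.2 ^ 2 = 1) (v : Fin 3 → ℝ) (s : ℝ) :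
    Radon (fun y => dot3 (tensorFn f11 f12 f22 y) v) ξ s =
      dot3 v ![Radon f11 ξ s, Radon f12 ξ s, Radon f22 ξ s] := by
  have i1 := (integrable_line h11 hs11 hξ s).mul_const (v 0)
  have i2 := (integrable_line h12 hs12 hξ s).mul_const (v 1)
  have i3 := (integrable_line h22 hs22 hξ s).mul_const (v 2)
  simp only [Radon, dot3, tensorFn, Matrix.cons_val]
  rw [integral_add (by exact i1.add i2) i3, integral_add i1 i2, integral_mul_const,
    integral_mul_const, integral_mul_const]
  ring

theorem hasDerivAt_Radon_sum_Xray {m : ℕ} {γ : Fin m → ℝ × ℝ} (c : Fin m → ℝ)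
    (h11 : Continuous f11) (h12 : Continuous f12) (h22 : Continuous f22)
    (hs11 : HasCompactSupport f11) (hs12 : HasCompactSupport f12) (hs22 : HasCompactSupport f22)
    (hξ : ξ.1 ^ 2 + ξ.2 ^ 2 = 1) (hγ : ∀ i, dot2 ξ (γ i) ≠ 0) (v : Fin m → Fin 3 → ℝ) (s : ℝ) :
    HasDerivAt (fun s => Radon (fun x =>
        ∑ i, c i * Xray (γ i) (fun y => dot3 (tensorFn f11 f12 f22 y) (v i)) x) ξ s)
      (dot3 (-∑ i, (c i / dot2 ξ (γ i)) • v i) ![Radon f11 ξ s, Radon f12 ξ s, Radon f22 ξ s])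
      s := by
  have hc i := continuous_dot3_tensorFn h11 h12 h22 (v i)
  have hs i := hasCompactSupport_dot3_tensorFn hs11 hs12 hs22 (v i)
  have heq : (fun s => Radon (fun x =>
      ∑ i, c i * Xray (γ i) (fun y => dot3 (tensorFn f11 f12 f22 y) (v i)) x) ξ s) =
      fun s => ∑ i, c i *
        Radon (Xray (γ i) (fun y => dot3 (tensorFn f11 f12 f22 y) (v i))) ξ s := by
    ext s
    simp only [Radon]
    rw [integral_finsetSum _ fun i _ => (integrable_Xray_line (hc i) (hs i) (hγ i) s).const_mul _]
    simp only [integral_const_mul]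
  rw [heq]
  have hd := HasDerivAt.fun_sum (u := Finset.univ) fun i _ =>
    (hasDerivAt_Radon_Xray (hc i) (hs i) hξ (hγ i) s).const_mul (c i)
  refine hd.congr_deriv ?_
  simp only [Radon_dot3_tensorFn h11 h12 h22 hs11 hs12 hs22 hξ]
  simp only [dot3, Pi.neg_apply, Finset.sum_apply, Pi.smul_apply, smul_eq_mul, neg_mul,
    Finset.sum_mul, ← Finset.sum_neg_distrib, ← Finset.sum_add_distrib]
  refine Finset.sum_congr rfl fun i _ => ?_
  ring

end Star

theorem hasCompactSupport_of_tsupport_subset_unitDisk_s19 {f : ℝ × ℝ → ℝ}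
    (hf : tsupport f ⊆ unitDisk) : HasCompactSupport f := by
  refine HasCompactSupport.of_support_subset_isCompact
    (isCompact_Icc (a := ((-1, -1) : ℝ × ℝ)) (b := (1, 1))) fun x hx => ?_
  have h : x.1 ^ 2 + x.2 ^ 2 < 1 := hf (subset_tsupport f hx)
  refine ⟨⟨?_, ?_⟩, ⟨?_, ?_⟩⟩ <;> simp only <;> nlinarith [sq_nonneg x.1, sq_nonneg x.2]

theorem det_Qmat_ne_zero {m : ℕ} (γ : Fin m → ℝ × ℝ) (c : Fin m → ℝ)
    (hγunit : ∀ i, (γ i).1 ^ 2 + (γ i).2 ^ 2 = 1) (ξ : ℝ × ℝ)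
    (hdag : gammaDag γ c ξ ≠ 0) (hsum : (∑ i, c i / dot2 ξ (γ i)) ≠ 0) :
    (Qmat γ c ξ).det ≠ 0 := by
  set a : Fin m → ℝ := fun i => c i / dot2 ξ (γ i) with ha
  set A := ∑ i, a i * (γ i).1 ^ 2 with hA
  set B := ∑ i, a i * ((γ i).1 * (γ i).2) with hB
  set C := ∑ i, a i * (γ i).2 ^ 2 with hC
  have hAC : A + C = ∑ i, a i := by
    rw [hA, hC, ← Finset.sum_add_distrib]
    exact Finset.sum_congr rfl fun i _ => by rw [← mul_add, hγunit, mul_one]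
  have h1 : gammaVec γ c ξ = ![-A, -B, -C] := by
    ext k
    fin_cases k <;> simp [gammaVec, sq3, Finset.sum_apply, hA, hB, hC, ha]
  have h2 : gammaDag γ c ξ = ![B, -((A - C) / 2), -B] := by
    ext k
    fin_cases k <;>
      simp only [gammaDag, mix3, perp, Finset.sum_apply, hA, hB, hC, ha, Pi.neg_apply,
        Pi.smul_apply, smul_eq_mul, ← Finset.sum_neg_distrib, ← Finset.sum_sub_distrib,
        Finset.sum_div, Fin.zero_eta, Fin.mk_one, Fin.reduceFinMk, Matrix.cons_val] <;>
      exact Finset.sum_congr rfl fun i _ => by ring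
  have h3 : gammaPerpVec γ c ξ = ![-C, B, -A] := by
    ext k
    fin_cases k <;>
      simp only [gammaPerpVec, sq3, perp, Finset.sum_apply, hA, hB, hC, ha, Pi.neg_apply,
        Pi.smul_apply, smul_eq_mul, ← Finset.sum_neg_distrib,
        Fin.zero_eta, Fin.mk_one, Fin.reduceFinMk, Matrix.cons_val] <;>
      exact Finset.sum_congr rfl fun i _ => by ring
  have hdet : (Qmat γ c ξ).det = -((A + C) * ((A - C) ^ 2 / 2 + 2 * B ^ 2)) := by
    rw [Qmat, h1, h2, h3, Matrix.det_fin_three]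
    simp only [Matrix.of_apply, Matrix.cons_val]
    ring
  rw [hdet, neg_ne_zero]
  refine mul_ne_zero (hAC ▸ hsum) fun h0 => hdag ?_
  have hB0 : B = 0 := by nlinarith [sq_nonneg B, sq_nonneg (A - C)]
  have hAC0 : A - C = 0 := by nlinarith [sq_nonneg B, sq_nonneg (A - C)]
  rw [h2, hB0, hAC0]
  ext k
  fin_cases k <;> simp

theorem stmt_19 {m : ℕ} (γ : Fin m → ℝ × ℝ) (c : Fin m → ℝ)
    (hγdist : Function.Injective γ)
    (hγunit : ∀ i, (γ i).1 ^ 2 + (γ i).2 ^ 2 = 1)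
    (hc : ∀ i, c i ≠ 0)
    (f11 f12 f22 : ℝ × ℝ → ℝ)
    (hf11 : ContDiff ℝ 2 f11) (hf12 : ContDiff ℝ 2 f12) (hf22 : ContDiff ℝ 2 f22)
    (hs11 : tsupport f11 ⊆ unitDisk) (hs12 : tsupport f12 ⊆ unitDisk)
    (hs22 : tsupport f22 ⊆ unitDisk)
    (ξ : ℝ × ℝ) (hξ : ξ.1 ^ 2 + ξ.2 ^ 2 = 1)
    (hξγ : ∀ i, dot2 ξ (γ i) ≠ 0)
    (hdag : gammaDag γ c ξ ≠ 0)
    (hsum : (∑ i, c i / dot2 ξ (γ i)) ≠ 0) :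
    IsUnit (Qmat γ c ξ) ∧
      ∀ s : ℝ,
        ((Qmat γ c ξ)⁻¹).mulVec
            (fun i => deriv (fun s' => Radon (fun x => starT γ c f11 f12 f22 x i) ξ s') s) =
          ![Radon f11 ξ s, Radon f12 ξ s, Radon f22 ξ s] := by
  have hunit : IsUnit (Qmat γ c ξ).det := (det_Qmat_ne_zero γ c hγunit ξ hdag hsum).isUnit
  refine ⟨(Matrix.isUnit_iff_isUnit_det _).2 hunit, fun s => ?_⟩
  have key := hasDerivAt_Radon_sum_Xray c hf11.continuous hf12.continuous hf22.continuous
    (hasCompactSupport_of_tsupport_subset_unitDisk_s19 hs11)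
    (hasCompactSupport_of_tsupport_subset_unitDisk_s19 hs12)
    (hasCompactSupport_of_tsupport_subset_unitDisk_s19 hs22) hξ hξγ
  have hderiv : (fun i => deriv (fun s' => Radon (fun x => starT γ c f11 f12 f22 x i) ξ s') s) =
      (Qmat γ c ξ).mulVec ![Radon f11 ξ s, Radon f12 ξ s, Radon f22 ξ s] := by
    ext k
    rw [Matrix.mulVec, dotProduct, Fin.sum_univ_three]
    fin_cases k
    · simpa [starT, Finset.sum_apply, Qmat, gammaVec, dot3] using (key (fun i => sq3 (γ i)) s).deriv
    · simpa [starT, Finset.sum_apply, Qmat, gammaDag, dot3] using (key (fun i => mix3 (γ i)) s).deriv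
    · simpa [starT, Finset.sum_apply, Qmat, gammaPerpVec, dot3] using
        (key (fun i => sq3 (perp (γ i))) s).deriv
  rw [hderiv, Matrix.mulVec_mulVec, Matrix.nonsing_inv_mul _ hunit, Matrix.one_mulVec]
end
end
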